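/- arXiv:2511.09395 — 2 statements merged into one kernel-verified Lean document; each statement's English description precedes it below -/
import Mathlib

section
/- For every n ≥ 1, the Vidinli algebra V_{2n+1} is unital with two-sided unit e₁, i.e. e₁ ∗ a = a = a ∗ e₁ for all a ∈ ℝ^{2n+1}; moreover it is neither commutative nor associative: there exist a, b ∈ ℝ^{2n+1} with a ∗ b ≠ b ∗ a, and there exist a, b, c ∈ ℝ^{2n+1} with (a ∗ b) ∗ c ≠ a ∗ (b ∗ c). -/
noncomputable section

/-- Standard dot product on `ℝ^m`. -/
def dot {m : ℕ} (a b : Fin m → ℝ) : ℝ := ∑ i, a i * b i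

/-- The distinguished unit vector `e₁` of the Vidinli algebra (index `0`). -/
def e1 (n : ℕ) : Fin (2*n+1) → ℝ := fun i => if i.val = 0 then 1 else 0

/-- The standard symplectic form `ω` on `ℝ^{2n+1}` (vanishing on `e₁`):
`ω(a,b) = Σ_{k=1}^n (a_{2k} b_{2k+1} − a_{2k+1} b_{2k})` in the paper's 1-based indexing. -/
def omg (n : ℕ) (a b : Fin (2*n+1) → ℝ) : ℝ :=
  ∑ k : Fin n,
    (a ⟨2*k.val+1, by have := k.isLt; omega⟩ * b ⟨2*k.val+2, by have := k.isLt; omega⟩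
   - a ⟨2*k.val+2, by have := k.isLt; omega⟩ * b ⟨2*k.val+1, by have := k.isLt; omega⟩)

/-- The Vidinli multiplication on `ℝ^{2n+1}`. -/
def vprod (n : ℕ) (a b : Fin (2*n+1) → ℝ) : Fin (2*n+1) → ℝ :=
  dot a (e1 n) • b + dot b (e1 n) • a - dot a b • e1 n + omg n a b • e1 n

lemma e1_eq_single (n : ℕ) : e1 n = Pi.single 0 1 := by
  funext i
  simp [e1, Pi.single_apply]

lemma dot_comm {m : ℕ} (a b : Fin m → ℝ) : dot a b = dot b a := by
  simp [dot, mul_comm]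

lemma dot_single_one {m : ℕ} (a : Fin m → ℝ) (i : Fin m) : dot a (Pi.single i 1) = a i := by
  simp [dot, Pi.single_apply]

lemma dot_e1 (n : ℕ) (a : Fin (2*n+1) → ℝ) : dot a (e1 n) = a 0 := by
  rw [e1_eq_single, dot_single_one]

lemma omg_swap (n : ℕ) (a b : Fin (2*n+1) → ℝ) : omg n a b = -omg n b a := by
  simp only [omg, ← Finset.sum_neg_distrib]
  exact Finset.sum_congr rfl fun k _ => by ring

lemma omg_self (n : ℕ) (a : Fin (2*n+1) → ℝ) : omg n a a = 0 := by
  linarith [omg_swap n a a]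

lemma omg_e1 (n : ℕ) (a : Fin (2*n+1) → ℝ) : omg n a (e1 n) = 0 := by
  simp [omg, e1]

lemma vprod_e1 (n : ℕ) (a : Fin (2*n+1) → ℝ) : vprod n a (e1 n) = a := by
  have h : e1 n 0 = 1 := by simp [e1]
  simp [vprod, dot_e1, omg_e1, h]

lemma e1_vprod (n : ℕ) (a : Fin (2*n+1) → ℝ) : vprod n (e1 n) a = a := by
  have h : e1 n 0 = 1 := by simp [e1]
  simp [vprod, dot_comm (e1 n) a, omg_swap n (e1 n) a, dot_e1, omg_e1, h]

lemma vprod_of_apply_zero {n : ℕ} {a b : Fin (2*n+1) → ℝ} (ha : a 0 = 0) (hb : b 0 = 0) :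
    vprod n a b = (omg n a b - dot a b) • e1 n := by
  simp only [vprod, dot_e1, ha, hb, sub_smul, zero_smul]
  abel

lemma smul_e1_vprod (n : ℕ) (r : ℝ) (a : Fin (2*n+1) → ℝ) : vprod n (r • e1 n) a = r • a := by
  have h : vprod n (r • e1 n) a = r • vprod n (e1 n) a := by
    funext i
    simp only [vprod, dot, omg, Pi.add_apply, Pi.sub_apply, Pi.smul_apply, smul_eq_mul, mul_assoc,
      mul_left_comm _ r, ← mul_sub, ← Finset.mul_sum]
    ring
  rw [h, e1_vprod]

lemma omg_single_one_two (n : ℕ) (hn : 1 ≤ n) :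
    omg n (Pi.single ⟨1, by omega⟩ 1) (Pi.single ⟨2, by omega⟩ 1) = 1 := by
  rw [omg, Finset.sum_eq_single (⟨0, hn⟩ : Fin n)]
  · simp
  · intro k _ hk
    have hk0 : k.val ≠ 0 := fun h => hk (Fin.ext h)
    simp [hk0]
  · simp

/-- For every `n ≥ 1`, the Vidinli algebra `V_{2n+1}` is unital with
two-sided unit `e₁`, and is neither commutative nor associative. -/
theorem vidinli_unital_noncomm_nonassoc (n : ℕ) (hn : 1 ≤ n) :
    (∀ a : Fin (2*n+1) → ℝ, vprod n (e1 n) a = a ∧ vprod n a (e1 n) = a) ∧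
    (∃ a b : Fin (2*n+1) → ℝ, vprod n a b ≠ vprod n b a) ∧
    (∃ a b c : Fin (2*n+1) → ℝ,
      vprod n (vprod n a b) c ≠ vprod n a (vprod n b c)) := by
  have hω := omg_single_one_two n hn
  set x : Fin (2*n+1) → ℝ := Pi.single ⟨1, by omega⟩ 1 with hx
  set y : Fin (2*n+1) → ℝ := Pi.single ⟨2, by omega⟩ 1 with hy
  have hx0 : x 0 = 0 := by simp [hx, Fin.ext_iff]
  have hy0 : y 0 = 0 := by simp [hy, Fin.ext_iff]
  have hxx : dot x x = 1 := by rw [hx, dot_single_one, Pi.single_eq_same]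
  have hxy : dot x y = 0 := by simp [hy, dot_single_one, hx]
  have hxy_prod : vprod n x y = e1 n := by
    simp [vprod_of_apply_zero hx0 hy0, hω, hxy]
  have hyx_prod : vprod n y x = -e1 n := by
    simp [vprod_of_apply_zero hy0 hx0, omg_swap n y x, dot_comm y x, hω, hxy]
  have hxx_prod : vprod n x x = (-1 : ℝ) • e1 n := by
    simp [vprod_of_apply_zero hx0 hx0, omg_self, hxx]
  refine ⟨fun a => ⟨e1_vprod n a, vprod_e1 n a⟩, ⟨x, y, fun h => ?_⟩, ⟨x, x, y, fun h => ?_⟩⟩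
  · rw [hxy_prod, hyx_prod] at h
    have h0 := congrFun h 0
    norm_num [e1] at h0
  · rw [hxx_prod, smul_e1_vprod, hxy_prod, vprod_e1] at h
    have h1 := congrFun h ⟨1, by omega⟩
    simp [hx, hy] at h1
end
end

section
/- For every m ≥ 1, the Vidinli–Jordan algebra (ℝ^m, ∘) is simple: if I ⊆ ℝ^m is a linear subspace with a ∘ x ∈ I for all x ∈ I and all a ∈ ℝ^m, then I = {0} or I = ℝ^m. Moreover, for m ≥ 2 it is not formally real: e₁ ∘ e₁ + e₂ ∘ e₂ = 0 while e₂ ∘ e₂ ≠ 0. -/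
noncomputable section

/-- The `j`-th standard basis vector of `ℝ^m` (0-based index). -/
def ebv (m j : ℕ) : Fin m → ℝ := fun i => if i.val = j then 1 else 0

/-- The Vidinli–Jordan product on `ℝ^m`:
`a ∘ b = (a·e₁) b + (b·e₁) a − (a·b) e₁`, where `e₁ = ebv m 0`. -/
def jprod (m : ℕ) (a b : Fin m → ℝ) : Fin m → ℝ :=
  dot a (ebv m 0) • b + dot b (ebv m 0) • a - dot a b • ebv m 0

theorem dot_ebv {m j : ℕ} (hj : j < m) (a : Fin m → ℝ) : dot a (ebv m j) = a ⟨j, hj⟩ := by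
  have h (i : Fin m) : i.val = j ↔ i = ⟨j, hj⟩ := by simp [Fin.ext_iff]
  simp [dot, ebv, h]

theorem dot_self_eq_zero {m : ℕ} {a : Fin m → ℝ} : dot a a = 0 ↔ a = 0 :=
  dotProduct_self_eq_zero

/-- The vector `e₁` is a right unit. -/
theorem jprod_ebv_zero {m : ℕ} (hm : 0 < m) (a : Fin m → ℝ) : jprod m a (ebv m 0) = a := by
  have h : dot (ebv m 0) (ebv m 0) = 1 := by simp [dot_ebv hm, ebv]
  simp [jprod, h]

/-- The reflection of `x` in the line through `e₁` is, up to the scalar `x·x`, inverse to `x`. -/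
theorem jprod_reflection_self {m : ℕ} (hm : 0 < m) (x : Fin m → ℝ) :
    jprod m ((2 * dot x (ebv m 0)) • ebv m 0 - x) x = dot x x • ebv m 0 := by
  have hsub (b : Fin m → ℝ) : dot ((2 * dot x (ebv m 0)) • ebv m 0 - x) b =
      2 * dot x (ebv m 0) * dot (ebv m 0) b - dot x b := by
    simp only [dot, Pi.sub_apply, Pi.smul_apply, smul_eq_mul, sub_mul, mul_assoc,
      Finset.sum_sub_distrib, Finset.mul_sum]
  have hcomm : dot (ebv m 0) x = dot x (ebv m 0) := dotProduct_comm _ _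
  have h : dot (ebv m 0) (ebv m 0) = 1 := by simp [dot_ebv hm, ebv]
  rw [jprod, hsub, hsub, hcomm, h]
  module

/-- For every `m ≥ 1`, the Vidinli–Jordan algebra `(ℝ^m, ∘)` is simple;
moreover for `m ≥ 2` it is not formally real: `e₁∘e₁ + e₂∘e₂ = 0` while `e₂∘e₂ ≠ 0`. -/
theorem vidinli_jordan_simple_not_formally_real (m : ℕ) (hm : 1 ≤ m) :
    (∀ I : Submodule ℝ (Fin m → ℝ),
      (∀ x ∈ I, ∀ a : Fin m → ℝ, jprod m a x ∈ I) → I = ⊥ ∨ I = ⊤) ∧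
    (2 ≤ m →
      jprod m (ebv m 0) (ebv m 0) + jprod m (ebv m 1) (ebv m 1) = 0 ∧
      jprod m (ebv m 1) (ebv m 1) ≠ 0) := by
  refine ⟨fun I hI => ?_, fun h2 => ?_⟩
  · refine or_iff_not_imp_left.mpr fun hbot => ?_
    obtain ⟨x, hx, hx0⟩ := I.ne_bot_iff.mp hbot
    have hmem := hI x hx ((2 * dot x (ebv m 0)) • ebv m 0 - x)
    rw [jprod_reflection_self hm, I.smul_mem_iff (mt dot_self_eq_zero.mp hx0)] at hmem
    exact I.eq_top_iff'.mpr fun a => jprod_ebv_zero hm a ▸ hI _ hmem a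
  · have h₁ : jprod m (ebv m 1) (ebv m 1) = -ebv m 0 := by
      simp [jprod, dot_ebv hm, dot_ebv h2, ebv]
    refine ⟨by rw [jprod_ebv_zero hm, h₁, add_neg_cancel], fun h => ?_⟩
    simpa [h₁, ebv] using congrFun h ⟨0, hm⟩
end
end
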